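/- arXiv:2211.11715 — 8 statements merged into one kernel-verified Lean document; each statement's English description precedes it below -/
import Mathlib

section
/- Let β > 1/2, λ ≥ 0, ρ⁻ > 0, ρ⁺ > 0, ℓ ≥ 0, and let L : [−ρ⁻, ρ⁺] → [0, ∞) be integrable. If the fundamental inequality holds for (β, λ, ρ⁻, ρ⁺, ℓ, L), then (2β − 1)·( (∫_{−ρ⁻}^0 L(s) ds)/(ρ⁻)² + (∫_0^{ρ⁺} L(s) ds)/(ρ⁺)² ) ≤ 2βℓ·(1/ρ⁻ + 1/ρ⁺). -/
open MeasureTheory Set intervalIntegral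

/-- The *fundamental inequality* (equation (2.4) of the paper) for the data
`(β, λ, ρ⁻, ρ⁺, ℓ, L)`: for every test function on `[-ρ⁻, ρ⁺]` that is continuous,
twice continuously differentiable on each of `[-ρ⁻, 0]` and `[0, ρ⁺]`
(represented by two `C²` functions `φm`, `φp` agreeing at `0`, so that the
one-sided derivatives at `0` are `deriv φm 0` and `deriv φp 0`), nonnegative,
nondecreasing on `[-ρ⁻, 0]` and nonincreasing on `[0, ρ⁺]`, one has
`(2β−1)∫ L φ'² + 2β ∫ L φ φ'' + λ ∫ L φ² ≤ 2πβ(φ(ρ⁺)² + φ(−ρ⁻)²) + 2βℓ φ(0)(φ'(0⁻) − φ'(0⁺))`. -/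
def FundamentalIneq (β lam ρm ρp ℓ : ℝ) (L : ℝ → ℝ) : Prop :=
  ∀ φm φp : ℝ → ℝ,
    ContDiff ℝ 2 φm → ContDiff ℝ 2 φp →
    φm 0 = φp 0 →
    (∀ s ∈ Set.Icc (-ρm) (0:ℝ), 0 ≤ φm s) →
    (∀ s ∈ Set.Icc (0:ℝ) ρp, 0 ≤ φp s) →
    MonotoneOn φm (Set.Icc (-ρm) (0:ℝ)) →
    AntitoneOn φp (Set.Icc (0:ℝ) ρp) →
    (2 * β - 1) * ((∫ s in (-ρm)..(0:ℝ), L s * (deriv φm s) ^ 2) +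
        ∫ s in (0:ℝ)..ρp, L s * (deriv φp s) ^ 2) +
      2 * β * ((∫ s in (-ρm)..(0:ℝ), L s * φm s * deriv (deriv φm) s) +
        ∫ s in (0:ℝ)..ρp, L s * φp s * deriv (deriv φp) s) +
      lam * ((∫ s in (-ρm)..(0:ℝ), L s * (φm s) ^ 2) +
        ∫ s in (0:ℝ)..ρp, L s * (φp s) ^ 2)
    ≤ 2 * Real.pi * β * ((φp ρp) ^ 2 + (φm (-ρm)) ^ 2) +
      2 * β * ℓ * φp 0 * (deriv φm 0 - deriv φp 0)

lemma deriv_const_add_mul (a b : ℝ) : deriv (fun s : ℝ => b + a * s) = fun _ => a := by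
  funext s
  simp

/-- If `β > 1/2`, `λ ≥ 0`, `ρ⁻, ρ⁺ > 0`, `ℓ ≥ 0`, and the
fundamental inequality holds for an integrable `L : [−ρ⁻, ρ⁺] → [0, ∞)`, then
`(2β − 1)·( (∫_{−ρ⁻}^0 L)/(ρ⁻)² + (∫_0^{ρ⁺} L)/(ρ⁺)² ) ≤ 2βℓ·(1/ρ⁻ + 1/ρ⁺)`. -/
theorem stmt0 (β lam ρm ρp ℓ : ℝ) (hβ : 1 / 2 < β) (hlam : 0 ≤ lam)
    (hρm : 0 < ρm) (hρp : 0 < ρp) (hℓ : 0 ≤ ℓ) (L : ℝ → ℝ)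
    (hLint : IntervalIntegrable L volume (-ρm) ρp)
    (hLnn : ∀ s ∈ Set.Icc (-ρm) ρp, 0 ≤ L s)
    (hfund : FundamentalIneq β lam ρm ρp ℓ L) :
    (2 * β - 1) * ((∫ s in (-ρm)..(0:ℝ), L s) / ρm ^ 2 +
        (∫ s in (0:ℝ)..ρp, L s) / ρp ^ 2) ≤
      2 * β * ℓ * (1 / ρm + 1 / ρp) := by
  have hsq : ∀ a b : ℝ, -ρm ≤ a → a ≤ b → b ≤ ρp → ∀ φ : ℝ → ℝ,
      0 ≤ ∫ s in a..b, L s * φ s ^ 2 := fun a b ha hab hb φ =>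
    integral_nonneg hab fun s hs =>
      mul_nonneg (hLnn s ⟨ha.trans hs.1, hs.2.trans hb⟩) (sq_nonneg _)
  have hkey := hfund (fun s => 1 + ρm⁻¹ * s) (fun s => 1 + -ρp⁻¹ * s)
    (by fun_prop) (by fun_prop) (by simp)
    (fun s hs => by
      have h := mul_le_mul_of_nonneg_left hs.1 (inv_pos.2 hρm).le
      rw [mul_neg, inv_mul_cancel₀ hρm.ne'] at h
      linarith)
    (fun s hs => by
      have h := mul_le_mul_of_nonneg_left hs.2 (inv_pos.2 hρp).le
      rw [inv_mul_cancel₀ hρp.ne'] at h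
      linarith)
    (fun s _ t _ hst => by
      have h := mul_le_mul_of_nonneg_left hst (inv_pos.2 hρm).le
      dsimp only
      linarith)
    (fun s _ t _ hst => by
      have h := mul_le_mul_of_nonneg_left hst (inv_pos.2 hρp).le
      dsimp only
      linarith)
  have hpot : 0 ≤ lam * ((∫ s in (-ρm)..(0:ℝ), L s * (1 + ρm⁻¹ * s) ^ 2) +
      ∫ s in (0:ℝ)..ρp, L s * (1 + -ρp⁻¹ * s) ^ 2) :=
    mul_nonneg hlam (add_nonneg
      (hsq _ _ le_rfl (by linarith) hρp.le _) (hsq _ _ (by linarith) hρp.le le_rfl _))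
  have hm : 1 + ρm⁻¹ * -ρm = 0 := by field_simp; ring
  have hp : 1 + -ρp⁻¹ * ρp = 0 := by field_simp; ring
  simp only [deriv_const_add_mul, deriv_const, mul_zero, intervalIntegral.integral_zero,
    intervalIntegral.integral_mul_const, hm, hp, add_zero] at hkey
  simp only [div_eq_mul_inv, ← inv_pow, one_mul]
  linarith
end

section
/- Let β > 1/2, λ ≥ 0, ρ > 0, ℓ ≥ 0, and let L : [−ρ, ρ] → [0, ∞) be integrable. If the fundamental inequality holds for (β, λ, ρ, ρ, ℓ, L) (i.e. with ρ⁻ = ρ⁺ = ρ), then ∫_{−ρ}^{ρ} L(s) ds ≤ (4β/(2β − 1))·ρ·ℓ. -/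
open MeasureTheory Set intervalIntegral

/-- If `β > 1/2`, `λ ≥ 0`, `ρ > 0`, `ℓ ≥ 0`, and the fundamental
inequality holds for `(β, λ, ρ, ρ, ℓ, L)` with `L : [−ρ, ρ] → [0, ∞)` integrable,
then `∫_{−ρ}^{ρ} L(s) ds ≤ (4β/(2β − 1))·ρ·ℓ`. -/
theorem stmt1 (β lam ρ ℓ : ℝ) (hβ : 1 / 2 < β) (hlam : 0 ≤ lam)
    (hρ : 0 < ρ) (hℓ : 0 ≤ ℓ) (L : ℝ → ℝ)
    (hLint : IntervalIntegrable L volume (-ρ) ρ)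
    (hLnn : ∀ s ∈ Set.Icc (-ρ) ρ, 0 ≤ L s)
    (hfund : FundamentalIneq β lam ρ ρ ℓ L) :
    (∫ s in (-ρ)..ρ, L s) ≤ (4 * β / (2 * β - 1)) * ρ * ℓ := by
  have hm : ContDiff ℝ 2 (fun s : ℝ => ρ + s) := by fun_prop
  have hp : ContDiff ℝ 2 (fun s : ℝ => ρ - s) := by fun_prop
  have hdm : deriv (fun s : ℝ => ρ + s) = fun _ => 1 := by
    funext s
    simp
  have hdp : deriv (fun s : ℝ => ρ - s) = fun _ => -1 := by
    funext s
    simp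
  have h := hfund (fun s => ρ + s) (fun s => ρ - s) hm hp (by simp)
    (fun s hs => by linarith [hs.1]) (fun s hs => by linarith [hs.2])
    (fun a _ b _ hab => by dsimp only; linarith) (fun a _ b _ hab => by dsimp only; linarith)
  have hsplit : (∫ s in (-ρ)..(0 : ℝ), L s) + ∫ s in (0 : ℝ)..ρ, L s = ∫ s in (-ρ)..ρ, L s := by
    apply integral_add_adjacent_intervals <;> apply hLint.mono_set <;>
      apply uIcc_subset_uIcc <;> rw [mem_uIcc] <;> left <;> constructor <;> linarith
  have hIm : 0 ≤ ∫ s in (-ρ)..(0 : ℝ), L s * (ρ + s) ^ 2 :=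
    integral_nonneg (by linarith) fun s hs =>
      mul_nonneg (hLnn s ⟨hs.1, by linarith [hs.2]⟩) (sq_nonneg _)
  have hIp : 0 ≤ ∫ s in (0 : ℝ)..ρ, L s * (ρ - s) ^ 2 :=
    integral_nonneg hρ.le fun s hs =>
      mul_nonneg (hLnn s ⟨by linarith [hs.1], hs.2⟩) (sq_nonneg _)
  simp only [hdm, hdp, deriv_const', one_pow, even_two.neg_pow, mul_one, mul_zero,
    intervalIntegral.integral_zero, hsplit, sub_self, add_neg_cancel] at h
  have hlam_term := mul_nonneg hlam (add_nonneg hIm hIp)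
  have hb : 0 < 2 * β - 1 := by linarith
  rw [div_mul_eq_mul_div, div_mul_eq_mul_div, le_div_iff₀ hb]
  nlinarith
end

section
/- Let 1/4 < β ≤ 1/2 and ε > 0, and set p = (2β + ε)/(4β − 1). There exists a constant C = C(β, ε) > 0 with the following property: for all λ ≥ 0, all 0 < ρ⁻ ≤ ρ⁺, all ℓ ≥ 0, and every integrable L : [−ρ⁻, ρ⁺] → [0, ∞) for which the fundamental inequality holds for (β, λ, ρ⁻, ρ⁺, ℓ, L), if A⁻ := ∫_{−ρ⁻}^0 L(s) ds > 0 and A⁺ := ∫_0^{ρ⁺} L(s) ds, then, setting Z = A⁻/(ρ⁻)² + A⁺/(ρ⁺)², one has ℓ²/A⁻ ≥ C·min(1, Z^{2p−1}), where 2p − 1 = (1 + 2ε)/(4β − 1). -/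
open MeasureTheory Set intervalIntegral

/-- A real power agrees on `[δ, ∞)` with a function that is `C²` on the whole line. -/
lemma exists_contDiff_eq_rpow {δ : ℝ} (hδ : 0 < δ) (p : ℝ) :
    ∃ g : ℝ → ℝ, ContDiff ℝ 2 g ∧ ∀ x, δ ≤ x → g x = x ^ p := by
  let χ : ℝ → ℝ := fun x => Real.smoothTransition (x / δ)
  have hχ : ContDiff ℝ 2 χ := Real.smoothTransition.contDiff.comp (contDiff_id.div_const δ)
  refine ⟨fun x => (χ x * x + (1 - χ x) * δ) ^ p, ?_, fun x hx => ?_⟩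
  · refine ContDiff.rpow_const_of_ne (by fun_prop) fun x => ne_of_gt ?_
    rcases le_or_gt x 0 with hx | hx
    · have h : χ x = 0 := Real.smoothTransition.zero_of_nonpos
        (div_nonpos_of_nonpos_of_nonneg hx hδ.le)
      simpa [h] using hδ
    · have h0 : 0 ≤ χ x := Real.smoothTransition.nonneg _
      have h1 : χ x ≤ 1 := Real.smoothTransition.le_one _
      rcases h0.eq_or_lt with h | h
      · simpa [← h] using hδ
      · have := mul_pos h hx
        have := mul_nonneg (sub_nonneg.2 h1) hδ.le
        linarith
  · have h : χ x = 1 := Real.smoothTransition.one_of_one_le ((one_le_div hδ).2 hx)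
    simp [h]

lemma hasDerivAt_affine_rpow {k x : ℝ} (p : ℝ) (hx : 0 < 1 + k * x) :
    HasDerivAt (fun s => (1 + k * s) ^ p) (p * k * (1 + k * x) ^ (p - 1)) x := by
  have h : HasDerivAt (fun s : ℝ => 1 + k * s) k x := by
    simpa using ((hasDerivAt_id x).const_mul k).const_add 1
  convert h.rpow_const (p := p) (Or.inl hx.ne') using 1
  ring

/-- A `C²` test function `φ` equal to `(1 + k s) ^ p` wherever `1 + k s ≥ τ`, together with
its first two derivatives there. -/
lemma exists_affine_rpow_testFunction {τ : ℝ} (hτ : 0 < τ) (k p : ℝ) :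
    ∃ φ : ℝ → ℝ, ContDiff ℝ 2 φ ∧ ∀ s, τ ≤ 1 + k * s →
      φ s = (1 + k * s) ^ p ∧ deriv φ s = p * k * (1 + k * s) ^ (p - 1) ∧
      deriv (deriv φ) s = p * (p - 1) * k ^ 2 * (1 + k * s) ^ (p - 2) := by
  obtain ⟨g, hg, hgp⟩ := exists_contDiff_eq_rpow (half_pos hτ) p
  have hφ : ∀ s, τ / 2 < 1 + k * s →
      (fun s => g (1 + k * s)) =ᶠ[nhds s] fun s => (1 + k * s) ^ p := fun s hs => by
    have : ∀ᶠ t in nhds s, τ / 2 < 1 + k * t :=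
      (by fun_prop : Continuous fun t => 1 + k * t).continuousAt.eventually (lt_mem_nhds hs)
    filter_upwards [this] with t ht using hgp _ ht.le
  have hd : ∀ s, τ / 2 < 1 + k * s →
      deriv (fun s => g (1 + k * s)) s = p * k * (1 + k * s) ^ (p - 1) := fun s hs => by
    rw [(hφ s hs).deriv_eq]
    exact (hasDerivAt_affine_rpow p (by linarith)).deriv
  refine ⟨fun s => g (1 + k * s), hg.comp (by fun_prop), fun s hs => ?_⟩
  have hs' : τ / 2 < 1 + k * s := by linarith
  refine ⟨hgp _ hs'.le, hd s hs', ?_⟩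
  have hev : deriv (fun s => g (1 + k * s)) =ᶠ[nhds s]
      fun s => p * k * (1 + k * s) ^ (p - 1) := by
    have : ∀ᶠ t in nhds s, τ / 2 < 1 + k * t :=
      (by fun_prop : Continuous fun t => 1 + k * t).continuousAt.eventually (lt_mem_nhds hs')
    filter_upwards [this] with t ht using hd t ht
  rw [hev.deriv_eq,
    ((hasDerivAt_affine_rpow (p - 1) (by linarith)).const_mul (p * k)).deriv]
  rw [show p - 1 - 1 = p - 2 by ring]
  ring

/-- Lower bound for one side of the fundamental inequality tested with `(1 + k s) ^ p`. -/
lemma le_integral_affine_rpow {β p k τ u v : ℝ} {L φ : ℝ → ℝ} (huv : u ≤ v) (hτ : 0 < τ)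
    (hp : 1 ≤ p) (hβ : 0 ≤ (4 * β - 1) * p - 2 * β)
    (hL : IntervalIntegrable L volume u v) (hL0 : ∀ s ∈ Icc u v, 0 ≤ L s)
    (hk : ∀ s ∈ Icc u v, τ ≤ 1 + k * s)
    (hφ : ∀ s, τ ≤ 1 + k * s →
      φ s = (1 + k * s) ^ p ∧ deriv φ s = p * k * (1 + k * s) ^ (p - 1) ∧
      deriv (deriv φ) s = p * (p - 1) * k ^ 2 * (1 + k * s) ^ (p - 2)) :
    p * ((4 * β - 1) * p - 2 * β) * k ^ 2 * τ ^ (2 * p - 2) * (∫ s in u..v, L s) ≤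
      (2 * β - 1) * (∫ s in u..v, L s * deriv φ s ^ 2) +
        2 * β * ∫ s in u..v, L s * φ s * deriv (deriv φ) s := by
  have hM : IntervalIntegrable (fun s => L s * (1 + k * s) ^ (2 * p - 2)) volume u v := by
    refine hL.mul_continuousOn ?_
    exact (by fun_prop : ContinuousOn (fun s => 1 + k * s) _).rpow_const
      fun s _ => Or.inr (by linarith)
  have h1 : (∫ s in u..v, L s * deriv φ s ^ 2) =
      p ^ 2 * k ^ 2 * ∫ s in u..v, L s * (1 + k * s) ^ (2 * p - 2) := by
    rw [← intervalIntegral.integral_const_mul]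
    refine intervalIntegral.integral_congr fun s hs => ?_
    rw [uIcc_of_le huv] at hs
    have hx := hk s hs
    have hpow : (1 + k * s) ^ (2 * p - 2) = (1 + k * s) ^ (p - 1) * (1 + k * s) ^ (p - 1) := by
      rw [← Real.rpow_add (by linarith)]
      ring_nf
    simp only [(hφ s hx).2.1, hpow]
    ring
  have h2 : (∫ s in u..v, L s * φ s * deriv (deriv φ) s) =
      p * (p - 1) * k ^ 2 * ∫ s in u..v, L s * (1 + k * s) ^ (2 * p - 2) := by
    rw [← intervalIntegral.integral_const_mul]
    refine intervalIntegral.integral_congr fun s hs => ?_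
    rw [uIcc_of_le huv] at hs
    have hx := hk s hs
    have hpow : (1 + k * s) ^ (2 * p - 2) = (1 + k * s) ^ p * (1 + k * s) ^ (p - 2) := by
      rw [← Real.rpow_add (by linarith)]
      ring_nf
    simp only [(hφ s hx).1, (hφ s hx).2.2, hpow]
    ring
  have h3 : τ ^ (2 * p - 2) * (∫ s in u..v, L s) ≤
      ∫ s in u..v, L s * (1 + k * s) ^ (2 * p - 2) := by
    rw [← intervalIntegral.integral_const_mul]
    refine intervalIntegral.integral_mono_on huv (hL.const_mul _) hM fun s hs => ?_
    rw [mul_comm]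
    exact mul_le_mul_of_nonneg_left
      (Real.rpow_le_rpow hτ.le (hk s hs) (by linarith)) (hL0 s hs)
  have hc : 0 ≤ p * ((4 * β - 1) * p - 2 * β) * k ^ 2 := by positivity
  have := mul_le_mul_of_nonneg_left h3 hc
  rw [h1, h2]
  linarith

/-- The fundamental inequality tested with `(1 - b |s| / ρ^±) ^ p`. -/
lemma FundamentalIneq.test_rpow {β p lam ρm ρp ℓ b : ℝ} {L : ℝ → ℝ}
    (h : FundamentalIneq β lam ρm ρp ℓ L) (hβ0 : 0 ≤ β) (hp : 1 ≤ p)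
    (hβ : 0 ≤ (4 * β - 1) * p - 2 * β)
    (hlam : 0 ≤ lam) (hρm : 0 < ρm) (hρ : ρm ≤ ρp) (hℓ : 0 ≤ ℓ)
    (hL : IntervalIntegrable L volume (-ρm) ρp) (hL0 : ∀ s ∈ Icc (-ρm) ρp, 0 ≤ L s)
    (hb0 : 0 < b) (hb1 : b < 1) :
    p * ((4 * β - 1) * p - 2 * β) * b ^ 2 * (1 - b) ^ (2 * p - 2) *
        ((∫ s in (-ρm)..(0 : ℝ), L s) / ρm ^ 2 + (∫ s in (0 : ℝ)..ρp, L s) / ρp ^ 2) ≤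
      4 * Real.pi * β * (1 - b) ^ (2 * p) + 4 * β * p * ℓ * (b / ρm) := by
  have hτ : 0 < 1 - b := sub_pos.2 hb1
  have hρp : 0 < ρp := hρm.trans_le hρ
  obtain ⟨φm, hφm, Hm⟩ := exists_affine_rpow_testFunction hτ (b / ρm) p
  obtain ⟨φp, hφp, Hp⟩ := exists_affine_rpow_testFunction hτ (-(b / ρp)) p
  have hcm : b / ρm * ρm = b := div_mul_cancel₀ b hρm.ne'
  have hcp : b / ρp * ρp = b := div_mul_cancel₀ b hρp.ne'
  have hbm : 0 < b / ρm := div_pos hb0 hρm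
  have hbp : 0 < b / ρp := div_pos hb0 hρp
  have km : ∀ s ∈ Icc (-ρm) (0 : ℝ), 1 - b ≤ 1 + b / ρm * s := fun s hs => by
    nlinarith [mul_le_mul_of_nonneg_left hs.1 hbm.le]
  have kp : ∀ s ∈ Icc (0 : ℝ) ρp, 1 - b ≤ 1 + -(b / ρp) * s := fun s hs => by
    nlinarith [mul_le_mul_of_nonneg_left hs.2 hbp.le]
  have k0m := Hm 0 (by simpa using hb0.le)
  have k0p := Hp 0 (by simpa using hb0.le)
  simp only [mul_zero, add_zero, Real.one_rpow, mul_one] at k0m k0p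
  have hLm : IntervalIntegrable L volume (-ρm) 0 :=
    hL.mono_set (by
      rw [uIcc_of_le (by linarith), uIcc_of_le (by linarith)]
      exact Icc_subset_Icc_right hρp.le)
  have hLp : IntervalIntegrable L volume 0 ρp :=
    hL.mono_set (by
      rw [uIcc_of_le (by linarith), uIcc_of_le (by linarith)]
      exact Icc_subset_Icc_left (by linarith))
  have hL0m : ∀ s ∈ Icc (-ρm) (0 : ℝ), 0 ≤ L s := fun s hs => hL0 s ⟨hs.1, hs.2.trans hρp.le⟩
  have hL0p : ∀ s ∈ Icc (0 : ℝ) ρp, 0 ≤ L s := fun s hs => hL0 s ⟨by linarith [hs.1], hs.2⟩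
  have key := h φm φp hφm hφp (by rw [k0m.1, k0p.1])
    (fun s hs => by
      rw [(Hm s (km s hs)).1]
      exact Real.rpow_nonneg (hτ.le.trans (km s hs)) p)
    (fun s hs => by
      rw [(Hp s (kp s hs)).1]
      exact Real.rpow_nonneg (hτ.le.trans (kp s hs)) p)
    (fun s hs t ht hst => by
      rw [(Hm s (km s hs)).1, (Hm t (km t ht)).1]
      refine Real.rpow_le_rpow (hτ.le.trans (km s hs)) ?_ (by linarith)
      linarith [mul_le_mul_of_nonneg_left hst hbm.le])
    (fun s hs t ht hst => by
      rw [(Hp s (kp s hs)).1, (Hp t (kp t ht)).1]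
      refine Real.rpow_le_rpow (hτ.le.trans (kp t ht)) ?_ (by linarith)
      linarith [mul_le_mul_of_nonneg_left hst hbp.le])
  have em : φm (-ρm) = (1 - b) ^ p := by
    rw [(Hm _ (km _ ⟨le_rfl, by linarith⟩)).1, mul_neg, hcm, ← sub_eq_add_neg]
  have ep : φp ρp = (1 - b) ^ p := by
    rw [(Hp _ (kp _ ⟨hρp.le, le_rfl⟩)).1, neg_mul, hcp, ← sub_eq_add_neg]
  have epow : ((1 - b) ^ p) ^ 2 = (1 - b) ^ (2 * p) := by
    rw [← Real.rpow_mul_natCast hτ.le, mul_comm p]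
    norm_num
  have Im := le_integral_affine_rpow (by linarith) hτ hp hβ hLm hL0m km Hm
  have Ip := le_integral_affine_rpow hρp.le hτ hp hβ hLp hL0p kp Hp
  have Jm : 0 ≤ ∫ s in (-ρm)..(0 : ℝ), L s * φm s ^ 2 :=
    intervalIntegral.integral_nonneg (by linarith)
      fun s hs => mul_nonneg (hL0m s hs) (sq_nonneg _)
  have Jp : 0 ≤ ∫ s in (0 : ℝ)..ρp, L s * φp s ^ 2 :=
    intervalIntegral.integral_nonneg hρp.le
      fun s hs => mul_nonneg (hL0p s hs) (sq_nonneg _)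
  have hJ := mul_nonneg hlam (add_nonneg Jm Jp)
  rw [em, ep, epow, k0p.1, k0m.2.1, k0p.2.1] at key
  have hbb : b / ρp ≤ b / ρm := div_le_div_of_nonneg_left hb0.le hρm hρ
  have hc : 0 ≤ 2 * β * p * ℓ := by positivity
  have := mul_le_mul_of_nonneg_left hbb hc
  calc _ = p * ((4 * β - 1) * p - 2 * β) * (b / ρm) ^ 2 * (1 - b) ^ (2 * p - 2) *
            (∫ s in (-ρm)..(0 : ℝ), L s) +
          p * ((4 * β - 1) * p - 2 * β) * (-(b / ρp)) ^ 2 * (1 - b) ^ (2 * p - 2) *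
            (∫ s in (0 : ℝ)..ρp, L s) := by
        field_simp
    _ ≤ _ := by linarith

lemma min_div_four_mul_min_le {κ Z σ : ℝ} (hκ : 0 < κ) (hZ : 0 < Z) (hσ : 0 ≤ σ)
    (hσ2 : σ ^ 2 = κ * Z) : min 1 κ / 4 * min 1 Z ≤ σ ^ 2 / (1 + σ) ^ 2 := by
  rw [le_div_iff₀ (by positivity)]
  have m0 : 0 < min 1 κ * min 1 Z := by positivity
  have m1 : min 1 κ * min 1 Z ≤ 1 :=
    mul_le_one₀ (min_le_left _ _) (by positivity) (min_le_left _ _)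
  have m2 : min 1 κ * min 1 Z ≤ σ ^ 2 := by
    rw [hσ2]
    gcongr <;> exact min_le_right _ _
  have m3 : (1 + σ) ^ 2 ≤ 2 * (1 + σ ^ 2) := by nlinarith [sq_nonneg (1 - σ)]
  linarith [mul_le_mul_of_nonneg_left m3 m0.le, mul_le_mul_of_nonneg_right m1 (sq_nonneg σ)]

lemma min_one_rpow_le (Z q : ℝ) : min 1 (Z ^ q) ≤ min 1 Z ^ q := by
  rcases le_total 1 Z with h | h
  · rw [min_eq_left h, Real.one_rpow]
    exact min_le_left _ _
  · rw [min_eq_right h]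
    exact min_le_right _ _

/-- Let `1/4 < β ≤ 1/2`, `ε > 0` and `p = (2β + ε)/(4β − 1)`.
There is `C = C(β, ε) > 0` such that for all `λ ≥ 0`, `0 < ρ⁻ ≤ ρ⁺`, `ℓ ≥ 0` and
integrable `L : [−ρ⁻, ρ⁺] → [0, ∞)` satisfying the fundamental inequality, if
`A⁻ = ∫_{−ρ⁻}^0 L > 0` then, with `A⁺ = ∫_0^{ρ⁺} L` and
`Z = A⁻/(ρ⁻)² + A⁺/(ρ⁺)²`, one has `ℓ²/A⁻ ≥ C·min(1, Z^(2p−1))`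
(real power, where `2p − 1 = (1 + 2ε)/(4β − 1)`). -/
theorem stmt2 (β ε : ℝ) (hβ1 : 1 / 4 < β) (hβ2 : β ≤ 1 / 2) (hε : 0 < ε) :
    ∃ C > (0:ℝ), ∀ lam ρm ρp ℓ : ℝ, 0 ≤ lam → 0 < ρm → ρm ≤ ρp → 0 ≤ ℓ →
      ∀ L : ℝ → ℝ, IntervalIntegrable L volume (-ρm) ρp →
        (∀ s ∈ Set.Icc (-ρm) ρp, 0 ≤ L s) →
        FundamentalIneq β lam ρm ρp ℓ L →
        0 < (∫ s in (-ρm)..(0:ℝ), L s) →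
        C * min 1
            (((∫ s in (-ρm)..(0:ℝ), L s) / ρm ^ 2 +
                (∫ s in (0:ℝ)..ρp, L s) / ρp ^ 2) ^
              (2 * ((2 * β + ε) / (4 * β - 1)) - 1))
          ≤ ℓ ^ 2 / (∫ s in (-ρm)..(0:ℝ), L s) := by
  have hd : 0 < 4 * β - 1 := by linarith
  have hβ0 : 0 < β := by linarith
  set p := (2 * β + ε) / (4 * β - 1) with hpdef
  have hpe : (4 * β - 1) * p - 2 * β = ε := by
    rw [hpdef]
    field_simp
    ring
  have hp : 1 ≤ p := by
    rw [hpdef, one_le_div hd]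
    linarith
  have hp0 : 0 < p := by linarith
  have hq : 0 ≤ 2 * p - 1 := by linarith
  have hπ := Real.pi_pos
  set κ := p * ε / (8 * Real.pi * β) with hκdef
  have hκ : 0 < κ := by positivity
  refine ⟨Real.pi * ε / (8 * β * p) * (min 1 κ / 4) ^ (2 * p - 1), by positivity, ?_⟩
  intro lam ρm ρp ℓ hlam hρm hρ hℓ L hL hL0 hF hA
  set A := ∫ s in (-ρm)..(0 : ℝ), L s
  have hρp : 0 < ρp := hρm.trans_le hρ
  have hB : 0 ≤ ∫ s in (0 : ℝ)..ρp, L s :=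
    intervalIntegral.integral_nonneg hρp.le fun s hs => hL0 s ⟨by linarith [hs.1], hs.2⟩
  set Z := A / ρm ^ 2 + (∫ s in (0 : ℝ)..ρp, L s) / ρp ^ 2
  have hAZ : A / ρm ^ 2 ≤ Z := le_add_of_nonneg_right (by positivity)
  have hZ : 0 < Z := lt_of_lt_of_le (by positivity) hAZ
  set σ := Real.sqrt (κ * Z)
  have hσ : 0 < σ := Real.sqrt_pos.2 (by positivity)
  have hσ2 : σ ^ 2 = κ * Z := Real.sq_sqrt (by positivity)
  set b := 1 / (1 + σ) with hbdef
  have hb0 : 0 < b := by positivity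
  have hτ : 1 - b = σ * b := by
    rw [hbdef]
    field_simp
    ring
  have hτ0 : 0 < 1 - b := hτ ▸ mul_pos hσ hb0
  have key := hF.test_rpow hβ0.le hp (hpe ▸ hε.le) hlam hρm hρ hℓ hL hL0 hb0 (by linarith)
  rw [hpe] at key
  set τ := 1 - b with hτdef
  have hbZ : p * ε * b ^ 2 * Z = 8 * Real.pi * β * τ ^ 2 := by
    rw [hτ, mul_pow, hσ2, hκdef]
    field_simp
  have hpow : τ ^ (2 * p) = τ ^ (2 * p - 2) * τ ^ 2 := by
    rw [← Real.rpow_natCast τ 2, ← Real.rpow_add hτ0]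
    norm_num
  have hlow : Real.pi * τ ^ (2 * p) ≤ p * ℓ * (b / ρm) := by
    have h1 : p * ε * b ^ 2 * τ ^ (2 * p - 2) * Z = 8 * Real.pi * β * τ ^ (2 * p) := by
      rw [hpow]
      linear_combination τ ^ (2 * p - 2) * hbZ
    have h2 : 4 * β * (Real.pi * τ ^ (2 * p)) ≤ 4 * β * (p * ℓ * (b / ρm)) := by
      have := h1.symm.trans_le key
      linarith
    exact le_of_mul_le_mul_left h2 (by positivity)
  have hsq : Real.pi ^ 2 * (τ ^ (2 * p - 1) * τ ^ (2 * p - 1)) * τ ^ 2 ≤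
      p ^ 2 * ℓ ^ 2 * (b ^ 2 / ρm ^ 2) := by
    have h1 := pow_le_pow_left₀ (by positivity) hlow 2
    have h2 : τ ^ (2 * p) = τ ^ (2 * p - 1) * τ := by
      rw [← Real.rpow_add_one hτ0.ne']
      norm_num
    rw [h2] at h1
    calc _ = (Real.pi * (τ ^ (2 * p - 1) * τ)) ^ 2 := by ring
      _ ≤ _ := h1
      _ = _ := by ring
  have hmain : Real.pi * ε / (8 * β * p) * (τ ^ (2 * p - 1) * τ ^ (2 * p - 1)) ≤ ℓ ^ 2 / A := by
    set X := τ ^ (2 * p - 1) * τ ^ (2 * p - 1)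
    rw [le_div_iff₀ hA]
    have h1 : A ≤ Z * ρm ^ 2 := (div_le_iff₀ (by positivity)).1 hAZ
    calc Real.pi * ε / (8 * β * p) * X * A
        ≤ Real.pi * ε / (8 * β * p) * X * (Z * ρm ^ 2) := by gcongr
      _ = Real.pi ^ 2 * X * τ ^ 2 * (ρm ^ 2 / (p ^ 2 * b ^ 2)) := by
        have : τ ^ 2 = p * ε * b ^ 2 * Z / (8 * Real.pi * β) := by
          rw [hbZ]
          field_simp
        rw [this]
        field_simp
      _ ≤ p ^ 2 * ℓ ^ 2 * (b ^ 2 / ρm ^ 2) * (ρm ^ 2 / (p ^ 2 * b ^ 2)) := by gcongr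
      _ = ℓ ^ 2 := by field_simp
  have hmin : min 1 κ / 4 * min 1 Z ≤ τ * τ := by
    have hτσ : τ * τ = σ ^ 2 / (1 + σ) ^ 2 := by
      rw [hτ, hbdef]
      field_simp
    rw [hτσ]
    exact min_div_four_mul_min_le hκ hZ hσ.le hσ2
  have hminZ := min_one_rpow_le Z (2 * p - 1)
  calc _ ≤ Real.pi * ε / (8 * β * p) * (min 1 κ / 4) ^ (2 * p - 1) * min 1 Z ^ (2 * p - 1) := by
        gcongr
    _ = Real.pi * ε / (8 * β * p) * (min 1 κ / 4 * min 1 Z) ^ (2 * p - 1) := by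
        rw [mul_assoc, Real.mul_rpow (by positivity) (by positivity)]
    _ ≤ Real.pi * ε / (8 * β * p) * (τ * τ) ^ (2 * p - 1) := by gcongr
    _ = Real.pi * ε / (8 * β * p) * (τ ^ (2 * p - 1) * τ ^ (2 * p - 1)) := by
        rw [Real.mul_rpow hτ0.le hτ0.le]
    _ ≤ _ := hmain
end

section
/- Let β > 1/4 and λ ≥ 0. There exists a constant C = C(β) > 0 with the following property: for every r > 0, ℓ ≥ 0, and integrable L : [0, 2r] → [0, ∞), if for every twice continuously differentiable nonincreasing function φ : [0, 2r] → [0, ∞) with φ(2r) = 0 one has (2β − 1)∫_0^{2r} L(s)φ'(s)² ds + 2β∫_0^{2r} L(s)φ(s)φ''(s) ds + λ∫_0^{2r} L(s)φ(s)² ds ≤ 4πβ·φ(0)² + 2βℓ·φ(0)·|φ'(0)|, then ∫_0^r L(s) ds ≤ C·(r² + ℓ·r). -/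
open MeasureTheory Set intervalIntegral

theorem hasDerivAt_one_sub_div_pow (n : ℕ) (a s : ℝ) :
    HasDerivAt (fun t : ℝ => (1 - t / a) ^ (n + 1)) (-((n + 1) / a) * (1 - s / a) ^ n) s := by
  have h : HasDerivAt (fun t : ℝ => 1 - t / a) (-(1 / a)) s :=
    ((hasDerivAt_id s).div_const a).const_sub 1
  refine (h.pow (n + 1)).congr_deriv ?_
  push_cast
  ring

theorem deriv_one_sub_div_pow (n : ℕ) (a : ℝ) :
    deriv (fun t : ℝ => (1 - t / a) ^ (n + 1)) = fun s => -((n + 1) / a) * (1 - s / a) ^ n :=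
  funext fun s => (hasDerivAt_one_sub_div_pow n a s).deriv

theorem deriv_deriv_one_sub_div_pow (n : ℕ) (a : ℝ) :
    deriv (deriv fun t : ℝ => (1 - t / a) ^ (n + 2)) =
      fun s => (n + 2) * (n + 1) / a ^ 2 * (1 - s / a) ^ n := by
  funext s
  rw [deriv_one_sub_div_pow (n + 1) a,
    ((hasDerivAt_one_sub_div_pow n a s).const_mul _).deriv]
  push_cast
  ring

/-- The weight `(1 - s / (2r)) ^ m` is at least `(1 / 2) ^ m` on the first half of `[0, 2r]`. -/
theorem half_pow_mul_integral_le {L : ℝ → ℝ} {r : ℝ} (hr : 0 < r) (m : ℕ)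
    (hL : IntervalIntegrable L volume 0 (2 * r))
    (hL0 : ∀ s ∈ Set.Icc (0 : ℝ) (2 * r), 0 ≤ L s) :
    (1 / 2) ^ m * (∫ s in (0 : ℝ)..r, L s) ≤
      ∫ s in (0 : ℝ)..(2 * r), L s * (1 - s / (2 * r)) ^ m := by
  have hw : IntervalIntegrable (fun s => L s * (1 - s / (2 * r)) ^ m) volume 0 (2 * r) :=
    hL.mul_continuousOn (by fun_prop)
  have hsub : Set.uIcc 0 r ⊆ Set.uIcc 0 (2 * r) := by
    rw [Set.uIcc_of_le hr.le, Set.uIcc_of_le (by linarith)]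
    exact Set.Icc_subset_Icc_right (by linarith)
  calc (1 / 2) ^ m * (∫ s in (0 : ℝ)..r, L s)
      = ∫ s in (0 : ℝ)..r, (1 / 2) ^ m * L s := (intervalIntegral.integral_const_mul _ _).symm
    _ ≤ ∫ s in (0 : ℝ)..r, L s * (1 - s / (2 * r)) ^ m := by
        refine integral_mono_on hr.le ((hL.mono_set hsub).const_mul _) (hw.mono_set hsub) ?_
        intro s hs
        have h1 : s / (2 * r) ≤ 1 / 2 := by
          rw [div_le_iff₀ (by linarith)]
          linarith [hs.2]
        rw [mul_comm]
        exact mul_le_mul_of_nonneg_left (pow_le_pow_left₀ (by norm_num) (by linarith) m)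
          (hL0 s ⟨hs.1, by linarith [hs.2]⟩)
    _ ≤ ∫ s in (0 : ℝ)..(2 * r), L s * (1 - s / (2 * r)) ^ m := by
        refine integral_mono_interval le_rfl hr.le (by linarith) ?_ hw
        filter_upwards [ae_restrict_mem measurableSet_Ioc] with s hs
        have h1 : s / (2 * r) ≤ 1 := div_le_one_of_le₀ hs.2 (by linarith)
        exact mul_nonneg (hL0 s ⟨hs.1.le, hs.2⟩) (pow_nonneg (by linarith) m)

/-- Let `β > 1/4`. There is a constant `C = C(β) > 0` such that:
for every `λ ≥ 0`, `r > 0`, `ℓ ≥ 0` and integrable `L : [0, 2r] → [0, ∞)`, if for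
every twice continuously differentiable nonincreasing `φ : [0, 2r] → [0, ∞)` with
`φ(2r) = 0` one has
`(2β−1)∫_0^{2r} L φ'² + 2β ∫_0^{2r} L φ φ'' + λ ∫_0^{2r} L φ²
  ≤ 4πβ φ(0)² + 2βℓ φ(0) |φ'(0)|`,
then `∫_0^r L ≤ C (r² + ℓ r)`. -/
theorem stmt3 (β : ℝ) (hβ : 1 / 4 < β) :
    ∃ C > (0:ℝ), ∀ lam : ℝ, 0 ≤ lam → ∀ r ℓ : ℝ, 0 < r → 0 ≤ ℓ →
      ∀ L : ℝ → ℝ, IntervalIntegrable L volume 0 (2 * r) →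
        (∀ s ∈ Set.Icc (0:ℝ) (2 * r), 0 ≤ L s) →
        (∀ φ : ℝ → ℝ, ContDiff ℝ 2 φ →
          (∀ s ∈ Set.Icc (0:ℝ) (2 * r), 0 ≤ φ s) →
          AntitoneOn φ (Set.Icc (0:ℝ) (2 * r)) →
          φ (2 * r) = 0 →
          (2 * β - 1) * (∫ s in (0:ℝ)..(2 * r), L s * (deriv φ s) ^ 2) +
            2 * β * (∫ s in (0:ℝ)..(2 * r), L s * φ s * deriv (deriv φ) s) +
            lam * (∫ s in (0:ℝ)..(2 * r), L s * (φ s) ^ 2)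
          ≤ 4 * Real.pi * β * (φ 0) ^ 2 + 2 * β * ℓ * φ 0 * |deriv φ 0|) →
        (∫ s in (0:ℝ)..r, L s) ≤ C * (r ^ 2 + ℓ * r) := by
  obtain ⟨n, hn⟩ := exists_nat_gt (2 * β / (4 * β - 1))
  have hβ' : 0 < 4 * β - 1 := by linarith
  rw [div_lt_iff₀ hβ'] at hn
  set p : ℝ := n + 2 with hp
  have hp0 : 0 < p := by positivity
  set K : ℝ := (4 * β - 1) * p ^ 2 - 2 * β * p with hK
  have hK0 : 0 < K := by
    have h : K = p * (n * (4 * β - 1) - 2 * β + 2 * (4 * β - 1)) := by rw [hK, hp]; ring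
    rw [h]
    exact mul_pos hp0 (by linarith)
  have hβ0 : 0 < β := by linarith
  refine ⟨4 * 2 ^ (2 * n + 2) / K * (4 * Real.pi * β + 2 * β * p), by positivity, ?_⟩
  intro lam hlam r ℓ hr hℓ L hL hL0 H
  have hu : ∀ s ∈ Set.Icc (0 : ℝ) (2 * r), 0 ≤ 1 - s / (2 * r) := fun s hs =>
    sub_nonneg.2 (div_le_one_of_le₀ hs.2 (by linarith))
  have key := H (fun s => (1 - s / (2 * r)) ^ (n + 2)) (by fun_prop)
    (fun s hs => pow_nonneg (hu s hs) _)
    (fun s _ t ht hst => pow_le_pow_left₀ (hu t ht) (by gcongr) _)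
    (by simp [hr.ne'])
  rw [deriv_deriv_one_sub_div_pow, deriv_one_sub_div_pow (n + 1)] at key
  set I := ∫ s in (0 : ℝ)..(2 * r), L s * (1 - s / (2 * r)) ^ (2 * n + 2) with hI
  have h1 : (∫ s in (0 : ℝ)..(2 * r),
      L s * (-(((n + 1 : ℕ) + 1) / (2 * r)) * (1 - s / (2 * r)) ^ (n + 1)) ^ 2) =
      p ^ 2 / (2 * r) ^ 2 * I := by
    rw [hI, ← intervalIntegral.integral_const_mul]
    congr 1
    funext s
    rw [hp]
    push_cast
    ring
  have h2 : (∫ s in (0 : ℝ)..(2 * r), L s * (1 - s / (2 * r)) ^ (n + 2) *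
      ((n + 2) * (n + 1) / (2 * r) ^ 2 * (1 - s / (2 * r)) ^ n)) =
      p * (p - 1) / (2 * r) ^ 2 * I := by
    rw [hI, ← intervalIntegral.integral_const_mul]
    congr 1
    funext s
    rw [hp]
    ring
  have h3 : 0 ≤ lam * ∫ s in (0 : ℝ)..(2 * r), L s * ((1 - s / (2 * r)) ^ (n + 2)) ^ 2 :=
    mul_nonneg hlam (integral_nonneg (by linarith)
      fun s hs => mul_nonneg (hL0 s hs) (sq_nonneg _))
  have h4 : |-(((n + 1 : ℕ) + 1) / (2 * r)) * (1 - 0 / (2 * r)) ^ (n + 1)| = p / (2 * r) := by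
    rw [zero_div, sub_zero, one_pow, mul_one, abs_neg, abs_of_nonneg (by positivity), hp]
    push_cast
    ring
  simp only [h1, h2, h4] at key
  simp only [zero_div, sub_zero, one_pow, mul_one] at key
  have hlow := half_pow_mul_integral_le hr (2 * n + 2) hL hL0
  rw [← hI, one_div, inv_pow, inv_mul_le_iff₀ (by positivity)] at hlow
  have hKI : K * I ≤ 4 * ((4 * Real.pi * β) * r ^ 2 + β * p * (ℓ * r)) := by
    have h5 : K * I / (2 * r) ^ 2 ≤ 4 * Real.pi * β + 2 * β * ℓ * (p / (2 * r)) := by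
      refine le_trans (le_of_eq ?_) (le_trans (le_add_of_nonneg_right h3) key)
      rw [hK]
      ring
    rw [div_le_iff₀ (by positivity)] at h5
    refine h5.trans (le_of_eq ?_)
    field_simp
    ring
  have hI_le : I ≤ 4 * ((4 * Real.pi * β + 2 * β * p) * (r ^ 2 + ℓ * r)) / K := by
    rw [le_div_iff₀ hK0, mul_comm]
    refine hKI.trans ?_
    have a1 : 0 ≤ Real.pi * β * (ℓ * r) := by positivity
    have a2 : 0 ≤ β * p * r ^ 2 := by positivity
    have a3 : 0 ≤ β * p * (ℓ * r) := by positivity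
    linarith
  calc (∫ s in (0 : ℝ)..r, L s) ≤ 2 ^ (2 * n + 2) * I := hlow
    _ ≤ 2 ^ (2 * n + 2) * (4 * ((4 * Real.pi * β + 2 * β * p) * (r ^ 2 + ℓ * r)) / K) := by
        gcongr
    _ = _ := by ring
end

section
/- Let ρ > 0, let Γ : [0, ρ] → ℝ be integrable, and let L : [0, ρ] → [0, ∞) be bounded and differentiable almost everywhere with L' locally integrable. Assume: (i) there is δ₀ > 0 such that L is continuously differentiable on [0, δ₀] and L'(s) = Γ(s) for all s ∈ [0, δ₀]; (ii) L' ≤ Γ in the distributional sense, i.e. for every nonnegative smooth ψ compactly supported in (0, ρ), −∫_0^ρ L(s)ψ'(s) ds ≤ ∫_0^ρ Γ(s)ψ(s) ds; (iii) L(s₂) ≤ L(s₁) + ∫_{s₁}^{s₂} L'(t) dt for almost every pair 0 ≤ s₁ < s₂ ≤ ρ. Then for every smooth function f : [0, ρ] → (−∞, 0], one has ∫_0^ρ Γ(s)f(s) ds ≤ −∫_0^ρ L(s)f'(s) ds − L(0)f(0). -/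
open MeasureTheory Set intervalIntegral Filter Topology

/-- A bounded function that is continuous at almost every point of `[a, b]` is interval
integrable. -/
theorem intervalIntegrable_of_ae_continuousAt_of_bounded {u : ℝ → ℝ} {a b C : ℝ} (hab : a ≤ b)
    (hcont : ∀ᵐ s : ℝ, s ∈ Icc a b → ContinuousAt u s)
    (hbound : ∀ s ∈ Icc a b, ‖u s‖ ≤ C) : IntervalIntegrable u volume a b := by
  rw [intervalIntegrable_iff_integrableOn_Icc_of_le hab]
  set S : Set ℝ := {s | ContinuousAt u s}
  have hS : MeasurableSet S := (IsGδ.setOfPred_continuousAt u).measurableSet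
  have hSae : ∀ᵐ s ∂(volume.restrict (Icc a b)), s ∈ S :=
    (ae_restrict_iff' measurableSet_Icc).2 hcont
  have hmeas : AEStronglyMeasurable u (volume.restrict (Icc a b)) := by
    have hcontS : ContinuousOn u S := fun s hs => ContinuousAt.continuousWithinAt hs
    have h := hcontS.aestronglyMeasurable (μ := volume.restrict (Icc a b)) hS
    rwa [Measure.restrict_eq_self_of_ae_mem hSae] at h
  exact Integrable.of_bound hmeas C ((ae_restrict_iff' measurableSet_Icc).2 (ae_of_all _ hbound))

/-- A smooth step that vanishes for `n * s ≤ 1` and equals `1` for `2 ≤ n * s`. -/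
noncomputable def smoothStep (n : ℕ) (s : ℝ) : ℝ := Real.smoothTransition (n * s - 1)

namespace smoothStep

theorem contDiff (n : ℕ) : ContDiff ℝ (⊤ : ℕ∞) (smoothStep n) :=
  Real.smoothTransition.contDiff.comp ((contDiff_const.mul contDiff_id).sub contDiff_const)

theorem differentiable (n : ℕ) : Differentiable ℝ (smoothStep n) :=
  (contDiff n).differentiable (by simp)

theorem monotone (n : ℕ) : Monotone (smoothStep n) := fun _ _ h =>
  Real.smoothTransition.monotone
    (sub_le_sub_right (mul_le_mul_of_nonneg_left h n.cast_nonneg) 1)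

theorem nonneg (n : ℕ) (s : ℝ) : 0 ≤ smoothStep n s := Real.smoothTransition.nonneg _

theorem le_one (n : ℕ) (s : ℝ) : smoothStep n s ≤ 1 := Real.smoothTransition.le_one _

theorem eq_zero {n : ℕ} {s : ℝ} (h : n * s ≤ 1) : smoothStep n s = 0 :=
  Real.smoothTransition.zero_of_nonpos (by linarith)

theorem eq_one {n : ℕ} {s : ℝ} (h : 2 ≤ n * s) : smoothStep n s = 1 :=
  Real.smoothTransition.one_of_one_le (by linarith)

theorem deriv_eq_zero {n : ℕ} {s : ℝ} (h : 2 < n * s) : deriv (smoothStep n) s = 0 := by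
  have hev : smoothStep n =ᶠ[𝓝 s] fun _ => 1 := by
    have : ∀ᶠ t : ℝ in 𝓝 s, 2 < n * t :=
      (continuous_const.mul continuous_id).continuousAt.eventually (lt_mem_nhds h)
    filter_upwards [this] with t ht using eq_one ht.le
  rw [hev.deriv_eq, deriv_const]

theorem deriv_nonneg (n : ℕ) (s : ℝ) : 0 ≤ deriv (smoothStep n) s := (monotone n).deriv_nonneg

theorem tendsto_one {s : ℝ} (hs : 0 < s) : Tendsto (fun n => smoothStep n s) atTop (𝓝 1) := by
  have h : ∀ᶠ n : ℕ in atTop, 2 ≤ (n : ℝ) * s :=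
    (tendsto_natCast_atTop_atTop.atTop_mul_const hs).eventually_ge_atTop 2
  exact tendsto_const_nhds.congr' (h.mono fun n hn => (eq_one hn).symm)

theorem hasDerivAt (n : ℕ) (s : ℝ) : HasDerivAt (smoothStep n) (deriv (smoothStep n) s) s :=
  (differentiable n s).hasDerivAt

theorem hasDerivAt_reflect (n : ℕ) (ρ s : ℝ) :
    HasDerivAt (fun t => smoothStep n (ρ - t)) (-deriv (smoothStep n) (ρ - s)) s := by
  simpa using (hasDerivAt n (ρ - s)).comp_const_sub ρ s

end smoothStep

/-- A smooth bump on `[0, ρ]`, supported in the open interval and increasing to its indicator. -/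
noncomputable def intervalBump (ρ : ℝ) (n : ℕ) (s : ℝ) : ℝ :=
  smoothStep n s * smoothStep n (ρ - s)

namespace intervalBump

theorem contDiff (ρ : ℝ) (n : ℕ) : ContDiff ℝ (⊤ : ℕ∞) (intervalBump ρ n) :=
  (smoothStep.contDiff n).mul ((smoothStep.contDiff n).comp (contDiff_const.sub contDiff_id))

theorem nonneg (ρ : ℝ) (n : ℕ) (s : ℝ) : 0 ≤ intervalBump ρ n s :=
  mul_nonneg (smoothStep.nonneg _ _) (smoothStep.nonneg _ _)

theorem le_one (ρ : ℝ) (n : ℕ) (s : ℝ) : intervalBump ρ n s ≤ 1 :=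
  mul_le_one₀ (smoothStep.le_one _ _) (smoothStep.nonneg _ _) (smoothStep.le_one _ _)

theorem norm_le_one (ρ : ℝ) (n : ℕ) (s : ℝ) : ‖intervalBump ρ n s‖ ≤ 1 := by
  rw [Real.norm_of_nonneg (nonneg ρ n s)]
  exact le_one ρ n s

theorem support_subset (ρ : ℝ) {n : ℕ} (hn : 0 < n) :
    Function.support (intervalBump ρ n) ⊆ Icc (1 / (n : ℝ)) (ρ - 1 / n) := by
  have hn' : (0 : ℝ) < n := by exact_mod_cast hn
  intro s hs
  have h₁ : ¬ (n : ℝ) * s ≤ 1 := fun h => hs (by simp [intervalBump, smoothStep.eq_zero h])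
  have h₂ : ¬ (n : ℝ) * (ρ - s) ≤ 1 := fun h => hs (by simp [intervalBump, smoothStep.eq_zero h])
  have h₃ : 1 / (n : ℝ) ≤ s := by rw [div_le_iff₀ hn']; linarith
  have h₄ : 1 / (n : ℝ) ≤ ρ - s := by rw [div_le_iff₀ hn']; linarith
  exact ⟨h₃, by linarith⟩

/-- Multiplication by the bumps does not change an integral over `[0, ρ]` in the limit. -/
theorem tendsto_integral_mul {ρ : ℝ} (hρ : 0 ≤ ρ) {h : ℝ → ℝ}
    (hh : IntervalIntegrable h volume 0 ρ) :
    Tendsto (fun n => ∫ s in (0 : ℝ)..ρ, h s * intervalBump ρ n s) atTop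
      (𝓝 (∫ s in (0 : ℝ)..ρ, h s)) := by
  refine tendsto_integral_filter_of_dominated_convergence (fun s => ‖h s‖) ?_ ?_ hh.norm ?_
  · refine Eventually.of_forall fun n => ?_
    rw [uIoc_of_le hρ]
    exact hh.1.aestronglyMeasurable.mul (contDiff ρ n).continuous.aestronglyMeasurable
  · refine Eventually.of_forall fun n => ae_of_all _ fun s _ => ?_
    rw [norm_mul]
    exact mul_le_of_le_one_right (norm_nonneg _) (norm_le_one ρ n s)
  · have hne : ∀ᵐ s : ℝ, s ≠ ρ := by simp [ae_iff]
    filter_upwards [hne] with s hsρ hs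
    rw [uIoc_of_le hρ] at hs
    have h₁ := smoothStep.tendsto_one hs.1
    have h₂ := smoothStep.tendsto_one (sub_pos.2 (lt_of_le_of_ne hs.2 hsρ))
    simpa [intervalBump] using (h₁.mul h₂).const_mul (h s)

theorem hasDerivAt (ρ : ℝ) (n : ℕ) (s : ℝ) :
    HasDerivAt (intervalBump ρ n)
      (deriv (smoothStep n) s * smoothStep n (ρ - s) +
        smoothStep n s * -deriv (smoothStep n) (ρ - s)) s :=
  (smoothStep.hasDerivAt n s).mul (smoothStep.hasDerivAt_reflect n ρ s)

theorem tsupport_subset (ρ : ℝ) {n : ℕ} (hn : 0 < n) :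
    tsupport (intervalBump ρ n) ⊆ Icc (1 / (n : ℝ)) (ρ - 1 / n) :=
  closure_minimal (support_subset ρ hn) isClosed_Icc

theorem hasCompactSupport (ρ : ℝ) {n : ℕ} (hn : 0 < n) : HasCompactSupport (intervalBump ρ n) :=
  HasCompactSupport.of_support_subset_isCompact isCompact_Icc (support_subset ρ hn)

theorem tsupport_subset_Ioo (ρ : ℝ) {n : ℕ} (hn : 0 < n) :
    tsupport (intervalBump ρ n) ⊆ Ioo (0 : ℝ) ρ := by
  have hn' : 0 < 1 / (n : ℝ) := by positivity
  exact (tsupport_subset ρ hn).trans fun s hs => ⟨by linarith [hs.1], by linarith [hs.2]⟩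

end intervalBump

/-- The only positive boundary contribution of a nonnegative test function cut off by
`intervalBump` comes from the left endpoint. -/
theorem integral_mul_deriv_mul_intervalBump_le {ρ c : ℝ} {L g : ℝ → ℝ} {n : ℕ} (hρ : 0 ≤ ρ)
    (hL : IntervalIntegrable L volume 0 ρ) (hg : ContDiff ℝ (⊤ : ℕ∞) g)
    (hL_nonneg : ∀ s ∈ Icc 0 ρ, 0 ≤ L s) (hg_nonneg : ∀ s ∈ Icc 0 ρ, 0 ≤ g s)
    (hnρ : 2 ≤ n * ρ) (hc : ∀ s ∈ Icc 0 ρ, n * s ≤ 2 → L s * g s ≤ c) :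
    ∫ s in (0 : ℝ)..ρ, L s * deriv (fun t => g t * intervalBump ρ n t) s ≤
      (∫ s in (0 : ℝ)..ρ, L s * deriv g s * intervalBump ρ n s) + c := by
  have hdg : Continuous (deriv g) := hg.continuous_deriv (by simp)
  have hdstep : Continuous (deriv (smoothStep n)) :=
    (smoothStep.contDiff n).continuous_deriv (by simp)
  have hdbump : Continuous (deriv fun t => g t * intervalBump ρ n t) :=
    (hg.mul (intervalBump.contDiff ρ n)).continuous_deriv (by simp)
  have hint₁ : IntervalIntegrable (fun s => L s * deriv g s * intervalBump ρ n s) volume 0 ρ :=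
    (hL.mul_continuousOn hdg.continuousOn).mul_continuousOn
      (intervalBump.contDiff ρ n).continuous.continuousOn
  have hint₂ : IntervalIntegrable (fun s => c * deriv (smoothStep n) s) volume 0 ρ :=
    (continuous_const.mul hdstep).intervalIntegrable _ _
  have hstep : ∫ s in (0 : ℝ)..ρ, c * deriv (smoothStep n) s = c := by
    rw [intervalIntegral.integral_const_mul, integral_deriv_eq_sub (fun s _ => smoothStep.differentiable n s)
      (hdstep.intervalIntegrable _ _), smoothStep.eq_one hnρ, smoothStep.eq_zero (by simp)]
    ring
  rw [← hstep, ← integral_add hint₁ hint₂]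
  refine integral_mono_on hρ (hL.mul_continuousOn hdbump.continuousOn) (hint₁.add hint₂) ?_
  intro s hs
  have hgs : HasDerivAt g (deriv g s) s := (hg.differentiable (by simp) s).hasDerivAt
  rw [(hgs.fun_mul (intervalBump.hasDerivAt ρ n s)).deriv]
  have hLg : 0 ≤ L s * g s := mul_nonneg (hL_nonneg s hs) (hg_nonneg s hs)
  have hright : 0 ≤ L s * g s * (smoothStep n s * deriv (smoothStep n) (ρ - s)) :=
    mul_nonneg hLg (mul_nonneg (smoothStep.nonneg _ _) (smoothStep.deriv_nonneg _ _))
  have hleft : L s * g s * (deriv (smoothStep n) s * smoothStep n (ρ - s)) ≤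
      c * deriv (smoothStep n) s := by
    rcases le_or_gt ((n : ℝ) * s) 2 with h | h
    · exact mul_le_mul (hc s hs h)
        (mul_le_of_le_one_right (smoothStep.deriv_nonneg _ _) (smoothStep.le_one _ _))
        (mul_nonneg (smoothStep.deriv_nonneg _ _) (smoothStep.nonneg _ _))
        (hLg.trans (hc s hs h))
    · simp [smoothStep.deriv_eq_zero h]
  linarith

/-- **integration by parts against a distributional derivative bound.**
Let `ρ > 0`, `Γ : [0, ρ] → ℝ` integrable, and `L : [0, ρ] → [0, ∞)` bounded and
differentiable almost everywhere with derivative `L'` (locally) integrable.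
Assume:
(i) for some `δ₀ > 0`, `L` is continuously differentiable on `[0, δ₀]` with
    `L' = Γ` there;
(ii) `L' ≤ Γ` distributionally: for every nonnegative smooth `ψ` compactly
    supported in `(0, ρ)`, `−∫_0^ρ L ψ' ≤ ∫_0^ρ Γ ψ`;
(iii) `L(s₂) ≤ L(s₁) + ∫_{s₁}^{s₂} L'` for almost every pair `0 ≤ s₁ < s₂ ≤ ρ`.
Then for every smooth `f : [0, ρ] → (−∞, 0]`,
`∫_0^ρ Γ f ≤ −∫_0^ρ L f' − L(0) f(0)`. -/
theorem stmt5 (ρ : ℝ) (hρ : 0 < ρ) (Γ L L' : ℝ → ℝ)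
    (hΓint : IntervalIntegrable Γ volume 0 ρ)
    (hLnn : ∀ s ∈ Set.Icc (0:ℝ) ρ, 0 ≤ L s)
    (hLbdd : ∃ M : ℝ, ∀ s ∈ Set.Icc (0:ℝ) ρ, L s ≤ M)
    (hLderiv : ∀ᵐ s : ℝ, s ∈ Set.Icc (0:ℝ) ρ → HasDerivAt L (L' s) s)
    (hL'int : IntervalIntegrable L' volume 0 ρ)
    (δ₀ : ℝ) (hδ₀ : 0 < δ₀) (hδ₀ρ : δ₀ ≤ ρ)
    (hC1 : ContinuousOn Γ (Set.Icc (0:ℝ) δ₀))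
    (hL'Γ : ∀ s ∈ Set.Icc (0:ℝ) δ₀, HasDerivAt L (Γ s) s)
    (hdistrib : ∀ ψ : ℝ → ℝ, ContDiff ℝ (⊤ : ℕ∞) ψ → HasCompactSupport ψ →
      tsupport ψ ⊆ Set.Ioo (0:ℝ) ρ → (∀ s, 0 ≤ ψ s) →
      -(∫ s in (0:ℝ)..ρ, L s * deriv ψ s) ≤ ∫ s in (0:ℝ)..ρ, Γ s * ψ s)
    (hFTC : ∀ᵐ p : ℝ × ℝ,
      p.1 ∈ Set.Icc (0:ℝ) ρ → p.2 ∈ Set.Icc (0:ℝ) ρ → p.1 < p.2 →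
      L p.2 ≤ L p.1 + ∫ t in p.1..p.2, L' t) :
    ∀ f : ℝ → ℝ, ContDiff ℝ (⊤ : ℕ∞) f → (∀ s ∈ Set.Icc (0:ℝ) ρ, f s ≤ 0) →
      (∫ s in (0:ℝ)..ρ, Γ s * f s) ≤
        -(∫ s in (0:ℝ)..ρ, L s * deriv f s) - L 0 * f 0 := by
  intro f hf hf_nonpos
  obtain ⟨M, hM⟩ := hLbdd
  have hL : IntervalIntegrable L volume 0 ρ :=
    intervalIntegrable_of_ae_continuousAt_of_bounded hρ.le
      (hLderiv.mono fun s h hs => (h hs).continuousAt)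
      fun s hs => by rw [Real.norm_of_nonneg (hLnn s hs)]; exact hM s hs
  set g : ℝ → ℝ := fun s => -f s with hg_def
  have hg : ContDiff ℝ (⊤ : ℕ∞) g := hf.neg
  have hg_nonneg : ∀ s ∈ Icc (0 : ℝ) ρ, 0 ≤ g s := fun s hs => neg_nonneg.2 (hf_nonpos s hs)
  have hLdg : IntervalIntegrable (fun s => L s * deriv g s) volume 0 ρ :=
    hL.mul_continuousOn (hg.continuous_deriv (by simp)).continuousOn
  have hΓg : IntervalIntegrable (fun s => Γ s * g s) volume 0 ρ :=
    hΓint.mul_continuousOn hg.continuous.continuousOn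
  have hcont : ContinuousAt (fun s => L s * g s) 0 :=
    (hL'Γ 0 ⟨le_rfl, hδ₀.le⟩).continuousAt.mul hg.continuous.continuousAt
  have key : 0 ≤ (∫ s in (0 : ℝ)..ρ, Γ s * g s) + (∫ s in (0 : ℝ)..ρ, L s * deriv g s) +
      L 0 * g 0 := by
    refine le_of_forall_pos_le_add fun ε hε => ?_
    obtain ⟨η, hη, hclose⟩ := Metric.continuousAt_iff.1 hcont ε hε
    have hlim := (((intervalBump.tendsto_integral_mul hρ.le hΓg).add
      (intervalBump.tendsto_integral_mul hρ.le hLdg)).add_const (L 0 * g 0)).add_const ε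
    refine ge_of_tendsto hlim ?_
    have hlarge : ∀ {x : ℝ}, 0 < x → ∀ᶠ n : ℕ in atTop, 2 < (n : ℝ) * x := fun hx =>
      (tendsto_natCast_atTop_atTop.atTop_mul_const hx).eventually_gt_atTop 2
    filter_upwards [hlarge hρ, hlarge hη, eventually_gt_atTop 0] with n hnρ hnη hn
    have hle : ∀ s ∈ Icc (0 : ℝ) ρ, n * s ≤ 2 → L s * g s ≤ L 0 * g 0 + ε := by
      intro s hs hns
      have hsη : s < η := lt_of_mul_lt_mul_left (hns.trans_lt hnη) n.cast_nonneg
      have h := hclose (x := s) (by rwa [Real.dist_eq, sub_zero, abs_of_nonneg hs.1])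
      rw [Real.dist_eq] at h
      linarith [(abs_lt.1 h).2]
    have hbump := integral_mul_deriv_mul_intervalBump_le hρ.le hL hg hLnn hg_nonneg hnρ.le hle
    have hsub : tsupport (fun t => g t * intervalBump ρ n t) ⊆ Ioo 0 ρ :=
      (tsupport_mul_subset_right).trans (intervalBump.tsupport_subset_Ioo ρ hn)
    have htest := hdistrib (fun t => g t * intervalBump ρ n t)
      (hg.mul (intervalBump.contDiff ρ n)) (intervalBump.hasCompactSupport ρ hn).mul_left hsub
      (fun s => by
        by_cases hs : s ∈ Ioo 0 ρ
        · exact mul_nonneg (hg_nonneg s (Ioo_subset_Icc_self hs)) (intervalBump.nonneg ρ n s)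
        · exact (image_eq_zero_of_notMem_tsupport fun h => hs (hsub h)).ge)
    simp only [← mul_assoc] at htest
    linarith
  simp only [hg_def, deriv.fun_neg, mul_neg, intervalIntegral.integral_neg] at key
  linarith
end

section
/- Let β > 1/4, λ > 0, L₀ > 0, and let a : [0, L₀] → ℝ be continuous. Suppose that for every continuously differentiable function ψ : [0, L₀] → ℝ with ψ(0) = ψ(L₀) = 0 one has ∫_0^{L₀} [ (1/4 − β)·a(t)²·ψ(t)² + ψ'(t)² + a(t)·ψ(t)·ψ'(t) − (λ/β)·ψ(t)² ] dt ≥ 0. Then L₀ ≤ 2πβ/√(λ(4β − 1)). -/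
open MeasureTheory Set intervalIntegral

/-- Completing the square: the cross term is absorbed when `β > 1/4`. -/
lemma quarter_sub_mul_sq_add_mul_le {β : ℝ} (hβ : 1 / 4 < β) (a x y : ℝ) :
    (1 / 4 - β) * a ^ 2 * x ^ 2 + a * x * y ≤ y ^ 2 / (4 * β - 1) := by
  have hd : 0 < 4 * β - 1 := by linarith
  rw [le_div_iff₀ hd]
  nlinarith [sq_nonneg ((4 * β - 1) * (a * x) - 2 * y)]

lemma integral_cos_sq_sub_sin_sq_pi_div {L : ℝ} (hL : 0 < L) (p q : ℝ) :
    ∫ t in (0 : ℝ)..L, (p * Real.cos (Real.pi / L * t) ^ 2 - q * Real.sin (Real.pi / L * t) ^ 2) =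
      (p - q) * L / 2 := by
  set c := Real.pi / L with hc
  have hc0 : c ≠ 0 := (div_pos Real.pi_pos hL).ne'
  have hcL : c * L = Real.pi := by rw [hc]; field_simp
  have hF : ∀ t ∈ uIcc 0 L, HasDerivAt
      (fun t => (p - q) * t / 2 + (p + q) * (Real.sin (c * t) * Real.cos (c * t)) / (2 * c))
      (p * Real.cos (c * t) ^ 2 - q * Real.sin (c * t) ^ 2) t := by
    intro t _
    have hlin : HasDerivAt (fun t => c * t) c t := by
      simpa using (hasDerivAt_id t).const_mul c
    have := (((hasDerivAt_id t).const_mul (p - q)).div_const 2).add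
      (((hlin.sin.mul hlin.cos).const_mul (p + q)).div_const (2 * c))
    refine this.congr_deriv ?_
    field_simp
    linear_combination -(p - q) * Real.sin_sq_add_cos_sq (c * t)
  rw [integral_eq_sub_of_hasDerivAt hF (Continuous.intervalIntegrable (by fun_prop) _ _)]
  simp [hcL]

/-- **analytic core of the weak Bonnet–Myers theorem.**
Let `β > 1/4`, `λ > 0`, `L₀ > 0`, and `a : [0, L₀] → ℝ` continuous. If for every
`C¹` function `ψ : [0, L₀] → ℝ` with `ψ(0) = ψ(L₀) = 0` one has
`∫_0^{L₀} [(1/4 − β) a² ψ² + ψ'² + a ψ ψ' − (λ/β) ψ²] dt ≥ 0`,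
then `L₀ ≤ 2πβ/√(λ(4β − 1))`. -/
theorem stmt6 (β lam L₀ : ℝ) (hβ : 1 / 4 < β) (hlam : 0 < lam) (hL₀ : 0 < L₀)
    (a : ℝ → ℝ) (ha : ContinuousOn a (Set.Icc (0:ℝ) L₀))
    (h : ∀ ψ : ℝ → ℝ, ContDiff ℝ 1 ψ → ψ 0 = 0 → ψ L₀ = 0 →
      0 ≤ ∫ t in (0:ℝ)..L₀,
        ((1 / 4 - β) * (a t) ^ 2 * (ψ t) ^ 2 + (deriv ψ t) ^ 2 +
          a t * ψ t * deriv ψ t - (lam / β) * (ψ t) ^ 2)) :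
    L₀ ≤ 2 * Real.pi * β / Real.sqrt (lam * (4 * β - 1)) := by
  have hd : 0 < 4 * β - 1 := by linarith
  have hβ0 : 0 < β := by linarith
  set c := Real.pi / L₀ with hc
  have hψ : ContDiff ℝ 1 (fun t => Real.sin (c * t)) := by fun_prop
  have hderiv : deriv (fun t => Real.sin (c * t)) = fun t => c * Real.cos (c * t) := by
    ext t
    have hlin : HasDerivAt (fun t => c * t) c t := by
      simpa using (hasDerivAt_id t).const_mul c
    rw [hlin.sin.deriv, mul_comm]
  have hcL : c * L₀ = Real.pi := by rw [hc]; field_simp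
  have hnonneg := h _ hψ (by simp) (by simp [hcL])
  simp only [hderiv] at hnonneg
  have hle := hnonneg.trans (integral_mono_on
    (g := fun t => 4 * β / (4 * β - 1) * c ^ 2 * Real.cos (c * t) ^ 2
      - lam / β * Real.sin (c * t) ^ 2) hL₀.le ?_
    (Continuous.intervalIntegrable (by fun_prop) _ _) ?_)
  · rw [integral_cos_sq_sub_sin_sq_pi_div hL₀] at hle
    have hpq : lam / β ≤ 4 * β / (4 * β - 1) * c ^ 2 := by
      by_contra! hlt
      nlinarith
    rw [hc, div_pow, div_mul_div_comm, div_le_div_iff₀ hβ0 (by positivity)] at hpq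
    rw [le_div_iff₀ (Real.sqrt_pos.2 (by positivity))]
    refine (sq_le_sq₀ (by positivity) (by positivity)).1 ?_
    rw [mul_pow, Real.sq_sqrt (by positivity)]
    linarith
  · refine ContinuousOn.intervalIntegrable ?_
    rw [uIcc_of_le hL₀.le]
    fun_prop
  · intro t _
    have hsq := quarter_sub_mul_sq_add_mul_le hβ (a t) (Real.sin (c * t)) (c * Real.cos (c * t))
    have hsplit : 4 * β / (4 * β - 1) * c ^ 2 * Real.cos (c * t) ^ 2 =
        (c * Real.cos (c * t)) ^ 2 + (c * Real.cos (c * t)) ^ 2 / (4 * β - 1) := by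
      field_simp
      ring
    linarith
end

section
/- Let β > 1/4, λ > 0, and 0 < ε < 1 − 1/(4β). Define C₁ = √( λ / (β(1 − 1/(4β) − ε)) ), C₂ = √( (λ/β)(1 − 1/(4β) − ε) ), and h(t) = C₁·cos(C₂ t)/sin(C₂ t) for t ∈ (0, π/C₂). Then for every t ∈ (0, π/C₂), one has |h'(t)| ≤ (1 − 1/(4β))·h(t)² + λ/β, with strict inequality whenever t ≠ π/(2C₂). -/
open Real Set

theorem hasDerivAt_const_mul_cos_div_sin (a b t : ℝ) (hs : Real.sin (b * t) ≠ 0) :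
    HasDerivAt (fun x : ℝ => a * Real.cos (b * x) / Real.sin (b * x))
      (-(a * b / Real.sin (b * t) ^ 2)) t := by
  have hb : HasDerivAt (fun x : ℝ => b * x) b t := by
    simpa using (hasDerivAt_id t).const_mul b
  refine ((hb.cos.const_mul a).div hb.sin hs).congr_deriv ?_
  field_simp
  linear_combination (-(a * b)) * Real.sin_sq_add_cos_sq (b * t)

/-- **the prescribed-curvature function in the μ-bubble proof.**
Let `β > 1/4`, `λ > 0`, `0 < ε < 1 − 1/(4β)`, and set
`C₁ = √(λ/(β(1 − 1/(4β) − ε)))`, `C₂ = √((λ/β)(1 − 1/(4β) − ε))` and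
`h(t) = C₁ cos(C₂ t)/sin(C₂ t)` on `(0, π/C₂)`. Then for every `t ∈ (0, π/C₂)`,
`|h'(t)| ≤ (1 − 1/(4β)) h(t)² + λ/β`, with strict inequality when
`t ≠ π/(2C₂)`. -/
theorem stmt7 (β lam ε C₁ C₂ : ℝ) (h : ℝ → ℝ)
    (hβ : 1 / 4 < β) (hlam : 0 < lam)
    (hε1 : 0 < ε) (hε2 : ε < 1 - 1 / (4 * β))
    (hC₁ : C₁ = Real.sqrt (lam / (β * (1 - 1 / (4 * β) - ε))))
    (hC₂ : C₂ = Real.sqrt (lam / β * (1 - 1 / (4 * β) - ε)))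
    (hh : ∀ t : ℝ, h t = C₁ * Real.cos (C₂ * t) / Real.sin (C₂ * t)) :
    ∀ t ∈ Set.Ioo (0:ℝ) (Real.pi / C₂),
      |deriv h t| ≤ (1 - 1 / (4 * β)) * (h t) ^ 2 + lam / β ∧
      (t ≠ Real.pi / (2 * C₂) →
        |deriv h t| < (1 - 1 / (4 * β)) * (h t) ^ 2 + lam / β) := by
  set κ := 1 - 1 / (4 * β)
  have hβ0 : 0 < β := by linarith
  have hδ : 0 < κ - ε := by linarith
  have hC₁sq : C₁ ^ 2 * (κ - ε) = lam / β := by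
    rw [hC₁, Real.sq_sqrt (by positivity)]
    field_simp
  have hC₁C₂ : C₁ * C₂ = lam / β := by
    rw [hC₁, hC₂, ← Real.sqrt_mul (by positivity), Real.sqrt_eq_iff_mul_self_eq (by positivity)
      (by positivity)]
    field_simp
  have hC₁0 : 0 < C₁ := hC₁ ▸ Real.sqrt_pos.2 (by positivity)
  have hC₂0 : 0 < C₂ := hC₂ ▸ Real.sqrt_pos.2 (by positivity)
  rintro t ⟨ht0, ht1⟩
  have hlow : 0 < C₂ * t := mul_pos hC₂0 ht0
  have hupp : C₂ * t < Real.pi := by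
    rw [lt_div_iff₀ hC₂0] at ht1
    linarith
  have hs : 0 < Real.sin (C₂ * t) := Real.sin_pos_of_pos_of_lt_pi hlow hupp
  have habs : |deriv h t| = (κ - ε) * h t ^ 2 + lam / β := by
    rw [show h = fun x => C₁ * Real.cos (C₂ * x) / Real.sin (C₂ * x) from funext hh,
      (hasDerivAt_const_mul_cos_div_sin C₁ C₂ t hs.ne').deriv, abs_neg,
      abs_of_nonneg (by positivity), hC₁C₂, ← hC₁sq]
    field_simp
    linear_combination -Real.sin_sq_add_cos_sq (C₂ * t)
  rw [habs]
  refine ⟨by nlinarith [mul_nonneg hε1.le (sq_nonneg (h t))], fun hne => ?_⟩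
  have hcos : Real.cos (C₂ * t) ≠ 0 := by
    intro hc
    have hmid : C₂ * t = Real.pi / 2 := by
      refine Real.injOn_cos ⟨hlow.le, hupp.le⟩ ⟨by positivity, by linarith [Real.pi_pos]⟩ ?_
      rw [hc, Real.cos_pi_div_two]
    apply hne
    field_simp
    linarith
  have hht : h t ≠ 0 := by
    rw [hh]
    exact div_ne_zero (mul_ne_zero hC₁0.ne' hcos) hs.ne'
  have : 0 < ε * h t ^ 2 := by positivity
  linarith
end

section
/- Let E be a real inner product space, and let x, v, N ∈ E with x ≠ 0, ‖v‖ = 1, ‖N‖ = 1, and ⟨v, N⟩ = 0. Suppose d₁, d₂ > 0 satisfy ⟨x, N⟩ ≥ d₁ and ‖x‖ ≤ d₂. Then, for Φ(x) = ‖x‖⁻¹·x, the derivative satisfies ‖DΦ_x(v)‖ ≥ d₁/d₂², where DΦ_x(v) = (‖x‖²·v − ⟨x, v⟩·x)/‖x‖³. -/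
open scoped RealInnerProductSpace

/-- Bessel's inequality for a pair of orthogonal unit vectors. -/
theorem inner_sq_add_inner_sq_le_norm_sq {E : Type*} [NormedAddCommGroup E]
    [InnerProductSpace ℝ E] (x : E) {v N : E} (hv : ‖v‖ = 1) (hN : ‖N‖ = 1)
    (hvN : ⟪v, N⟫ = 0) : ⟪x, v⟫ ^ 2 + ⟪x, N⟫ ^ 2 ≤ ‖x‖ ^ 2 := by
  have h := sq_nonneg ‖x - (⟪x, v⟫ • v + ⟪x, N⟫ • N)‖
  rw [norm_sub_sq_real, norm_add_sq_real] at h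
  simp only [inner_add_right, real_inner_smul_left, real_inner_smul_right, norm_smul, mul_pow,
    hv, hN, hvN, Real.norm_eq_abs, sq_abs] at h
  linarith

/-- The squared norm of the unnormalised derivative of the radial projection. -/
theorem norm_sq_smul_sub_inner_smul_sq {E : Type*} [NormedAddCommGroup E]
    [InnerProductSpace ℝ E] (x : E) {v : E} (hv : ‖v‖ = 1) :
    ‖‖x‖ ^ 2 • v - ⟪x, v⟫ • x‖ ^ 2 = ‖x‖ ^ 2 * (‖x‖ ^ 2 - ⟪x, v⟫ ^ 2) := by
  rw [norm_sub_sq_real]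
  simp only [real_inner_smul_left, real_inner_smul_right, norm_smul, mul_pow, hv,
    Real.norm_eq_abs, sq_abs, real_inner_comm x v]
  ring

/-- **lower bound for the radial projection, Lemma 4.4.**
Let `E` be a real inner product space, `x ≠ 0`, `v` and `N` unit vectors with
`⟨v, N⟩ = 0`, and `d₁, d₂ > 0` with `⟨x, N⟩ ≥ d₁` and `‖x‖ ≤ d₂`. Then the
derivative `DΦ_x(v) = (‖x‖² v − ⟨x, v⟩ x)/‖x‖³` of the radial projection
`Φ(x) = ‖x‖⁻¹ x` satisfies `‖DΦ_x(v)‖ ≥ d₁/d₂²`. -/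
theorem stmt12 {E : Type*} [NormedAddCommGroup E] [InnerProductSpace ℝ E]
    (x v N : E) (hx : x ≠ 0) (hv : ‖v‖ = 1) (hN : ‖N‖ = 1)
    (hvN : ⟪v, N⟫ = 0) (d₁ d₂ : ℝ) (hd₁ : 0 < d₁) (hd₂ : 0 < d₂)
    (hxN : d₁ ≤ ⟪x, N⟫) (hxd : ‖x‖ ≤ d₂) :
    d₁ / d₂ ^ 2 ≤ ‖(‖x‖ ^ 3)⁻¹ • (‖x‖ ^ 2 • v - ⟪x, v⟫ • x)‖ := by
  have hr : 0 < ‖x‖ := norm_pos_iff.mpr hx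
  have hw : ‖x‖ * d₁ ≤ ‖‖x‖ ^ 2 • v - ⟪x, v⟫ • x‖ := by
    refine abs_le_of_sq_le_sq' ?_ (norm_nonneg _) |>.2
    rw [norm_sq_smul_sub_inner_smul_sq x hv, mul_pow]
    gcongr
    have hd : d₁ ^ 2 ≤ ⟪x, N⟫ ^ 2 := by gcongr
    linarith [inner_sq_add_inner_sq_le_norm_sq x hv hN hvN]
  rw [norm_smul, norm_inv, norm_pow, norm_norm]
  calc d₁ / d₂ ^ 2 ≤ d₁ / ‖x‖ ^ 2 := by gcongr
    _ = (‖x‖ ^ 3)⁻¹ * (‖x‖ * d₁) := by field_simp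
    _ ≤ _ := by gcongr
end
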